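/- Let d ≥ 3 be an integer, 0 < α ≤ 1, κ > 0, and let β ∈ (0, α) satisfy β · ((d+β−2)/(d+β−α)) · (γ(d+β−2)/γ(d+β−α)) = κ. Then for every x ∈ ℝ^d with x ≠ 0: (i) the divergence of the vector field y ↦ κ|y|^{−α} y · |y|^{β} at x equals κ(d+β−α)|x|^{β−α}, and (ii) ( β(d+β−2) / γ(2−α) ) · ∫_{ℝ^d} |x−y|^{2−α−d} |y|^{β−2} dy = κ(d+β−α)|x|^{β−α}. (In other words, [(−Δ)^{α/2} + ∇·(κ|x|^{−α}x)] |x|^β = 0 pointwise on ℝ^d∖{0}, where (−Δ)^{α/2}|x|^β is represented as −(β(d+β−2)/γ(2−α)) ∫_{ℝ^d} |x−y|^{2−α−d} |y|^{β−2} dy.) -/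

import Mathlib

open Real MeasureTheory

/-- `γ(s) = 2^s π^{d/2} Γ(s/2) / Γ((d−s)/2)`, for an integer `d` and `s ∈ ℝ`. -/
noncomputable def gam (d : ℕ) (s : ℝ) : ℝ :=
  2 ^ s * Real.pi ^ ((d : ℝ) / 2) * Real.Gamma (s / 2) / Real.Gamma (((d : ℝ) - s) / 2)

/-- Pointwise divergence of a vector field on `ℝ^d`: `∑ i ∂_{x_i} v^i(x)`. -/
noncomputable def pdiv {d : ℕ} (v : EuclideanSpace ℝ (Fin d) → EuclideanSpace ℝ (Fin d))
    (x : EuclideanSpace ℝ (Fin d)) : ℝ :=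
  ∑ i : Fin d, fderiv ℝ v x (EuclideanSpace.single i 1) i

lemma exists_exp {t : ℝ} (ht : 0 < t) : ∃ a, t = Real.exp a := ⟨Real.log t, (Real.exp_log ht).symm⟩

lemma lint_gamma {s c : ℝ} (hs : 0 < s) (hc : 0 < c) :
    ∫⁻ t in Set.Ioi (0 : ℝ), ENNReal.ofReal (t ^ (s - 1) * Real.exp (-(c * t))) =
      ENNReal.ofReal ((1 / c) ^ s * Real.Gamma s) := by
  have h := Real.integral_rpow_mul_exp_neg_mul_Ioi hs hc
  have hG := Real.Gamma_pos_of_pos hs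
  have hpos : 0 < (1 / c) ^ s * Real.Gamma s := by positivity
  rw [← h, ofReal_integral_eq_lintegral_ofReal]
  · apply Integrable.of_integral_ne_zero
    rw [h]; exact hpos.ne'
  · filter_upwards [self_mem_ae_restrict measurableSet_Ioi] with t ht
    have : (0 : ℝ) < t := ht
    simp only [Pi.zero_apply]
    positivity

lemma lint_gauss {d : ℕ} (x : EuclideanSpace ℝ (Fin d)) {t r : ℝ} (ht : 0 < t) (hr : 0 < r) :
    ∫⁻ y : EuclideanSpace ℝ (Fin d),
      ENNReal.ofReal (Real.exp (-(‖x - y‖ ^ 2 * t) + -(‖y‖ ^ 2 * r))) =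
    ENNReal.ofReal ((Real.pi / (t + r)) ^ ((d : ℝ) / 2) *
      Real.exp (-(t * r / (t + r) * ‖x‖ ^ 2))) := by
  have htr : 0 < t + r := by positivity
  have key : ∀ y : EuclideanSpace ℝ (Fin d),
      Real.exp (-(‖x - y‖ ^ 2 * t) + -(‖y‖ ^ 2 * r)) =
      Real.exp (-(t + r) * ‖y - (t / (t + r)) • x‖ ^ 2) *
        Real.exp (-(t * r / (t + r) * ‖x‖ ^ 2)) := by
    intro y
    rw [← Real.exp_add, norm_sub_sq_real, norm_sub_sq_real, norm_smul, inner_smul_right,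
      real_inner_comm x y, mul_pow, Real.norm_eq_abs, sq_abs]
    congr 1
    field_simp
    ring
  have h := GaussianFourier.integral_rexp_neg_mul_sq_norm (V := EuclideanSpace ℝ (Fin d)) htr
  rw [finrank_euclideanSpace_fin] at h
  have hpos : 0 < (Real.pi / (t + r)) ^ ((d : ℝ) / 2) := by positivity
  simp_rw [key]
  simp_rw [ENNReal.ofReal_mul (Real.exp_nonneg _)]
  rw [lintegral_mul_const' _ _ ENNReal.ofReal_ne_top, ENNReal.ofReal_mul hpos.le]
  congr 1
  rw [lintegral_sub_right_eq_self
    (fun y : EuclideanSpace ℝ (Fin d) => ENNReal.ofReal (Real.exp (-(t + r) * ‖y‖ ^ 2)))]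
  rw [← h, ofReal_integral_eq_lintegral_ofReal]
  · apply Integrable.of_integral_ne_zero
    rw [h]; exact hpos.ne'
  · exact Filter.Eventually.of_forall fun y => Real.exp_nonneg _

lemma lint_scale {t : ℝ} (ht : 0 < t) (g : ℝ → ENNReal) :
    ∫⁻ r in Set.Ioi (0 : ℝ), g r = ∫⁻ v in Set.Ioi (0 : ℝ), ENNReal.ofReal t * g (t * v) := by
  have h := lintegral_image_eq_lintegral_abs_deriv_mul (s := Set.Ioi (0 : ℝ))
    (f := fun v => t * v) (f' := fun _ => t) measurableSet_Ioi
    (fun v _ => by simpa using ((hasDerivAt_id v).const_mul t).hasDerivWithinAt)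
    (fun a _ b _ hab => mul_left_cancel₀ ht.ne' hab) g
  have him : (fun v => t * v) '' Set.Ioi (0 : ℝ) = Set.Ioi 0 := by
    ext y
    simp only [Set.mem_image, Set.mem_Ioi]
    constructor
    · rintro ⟨v, hv, rfl⟩; positivity
    · intro hy; exact ⟨y / t, by positivity, by field_simp⟩
  rw [him] at h
  simpa [abs_of_pos ht] using h

lemma lint_beta {p q : ℝ} (hp : 0 < p) (hq : 0 < q) :
    ∫⁻ v in Set.Ioi (0 : ℝ), ENNReal.ofReal (v ^ (p - 1) * (1 + v) ^ (-(p + q))) =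
      ENNReal.ofReal (Real.Gamma p * Real.Gamma q / Real.Gamma (p + q)) := by
  have hGp := Real.Gamma_pos_of_pos hp
  have hGq := Real.Gamma_pos_of_pos hq
  have hG := Real.Gamma_pos_of_pos (add_pos hp hq)
  have e1 : ∀ v ∈ Set.Ioi (0 : ℝ),
      ENNReal.ofReal (Real.Gamma (p + q)) * ENNReal.ofReal (v ^ (p - 1) * (1 + v) ^ (-(p + q))) =
      ∫⁻ t in Set.Ioi (0 : ℝ), ENNReal.ofReal (v ^ (p - 1)) *
        ENNReal.ofReal (t ^ (p + q - 1) * Real.exp (-((1 + v) * t))) := by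
    intro v hv
    have hv : 0 < v := hv
    rw [lintegral_const_mul' _ _ ENNReal.ofReal_ne_top, lint_gamma (add_pos hp hq) (by positivity),
      ← ENNReal.ofReal_mul hG.le, ← ENNReal.ofReal_mul (by positivity)]
    congr 1
    rw [Real.rpow_neg (by positivity), one_div, Real.inv_rpow (by positivity)]
    ring
  have e2 : ∀ t ∈ Set.Ioi (0 : ℝ),
      (∫⁻ v in Set.Ioi (0 : ℝ), ENNReal.ofReal (v ^ (p - 1)) *
        ENNReal.ofReal (t ^ (p + q - 1) * Real.exp (-((1 + v) * t)))) =
      ENNReal.ofReal (Real.Gamma p) * ENNReal.ofReal (t ^ (q - 1) * Real.exp (-(1 * t))) := by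
    intro t ht
    have ht : 0 < t := ht
    have : ∀ v ∈ Set.Ioi (0 : ℝ), ENNReal.ofReal (v ^ (p - 1)) *
        ENNReal.ofReal (t ^ (p + q - 1) * Real.exp (-((1 + v) * t))) =
        ENNReal.ofReal (t ^ (p + q - 1) * Real.exp (-t)) *
        ENNReal.ofReal (v ^ (p - 1) * Real.exp (-(t * v))) := by
      intro v hv
      have hv : 0 < v := hv
      rw [← ENNReal.ofReal_mul (by positivity), ← ENNReal.ofReal_mul (by positivity)]
      congr 1
      rw [show -((1 + v) * t) = -t + -(t * v) by ring, Real.exp_add]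
      ring
    rw [setLIntegral_congr_fun measurableSet_Ioi this,
      lintegral_const_mul' _ _ ENNReal.ofReal_ne_top, lint_gamma hp ht,
      ← ENNReal.ofReal_mul (by positivity), ← ENNReal.ofReal_mul (by positivity)]
    congr 1
    rw [one_div, Real.inv_rpow ht.le, ← Real.rpow_neg ht.le,
      show t ^ (q - 1) = t ^ (p + q - 1) * t ^ (-p) by rw [← Real.rpow_add ht]; congr 1; ring]
    ring_nf
  have main : ENNReal.ofReal (Real.Gamma (p + q)) *
      ∫⁻ v in Set.Ioi (0 : ℝ), ENNReal.ofReal (v ^ (p - 1) * (1 + v) ^ (-(p + q))) =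
      ENNReal.ofReal (Real.Gamma p * Real.Gamma q) := by
    rw [← lintegral_const_mul' _ _ ENNReal.ofReal_ne_top,
      setLIntegral_congr_fun measurableSet_Ioi e1, lintegral_lintegral_swap,
      setLIntegral_congr_fun measurableSet_Ioi e2, lintegral_const_mul' _ _ ENNReal.ofReal_ne_top,
      lint_gamma hq one_pos, ← ENNReal.ofReal_mul hGp.le]
    · simp
    · apply Measurable.aemeasurable
      unfold Function.uncurry
      fun_prop
  have h0 : ENNReal.ofReal (Real.Gamma (p + q)) ≠ 0 := by simpa using hG
  rw [← ENNReal.mul_right_inj h0 ENNReal.ofReal_ne_top, main, ← ENNReal.ofReal_mul hG.le]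
  congr 1
  field_simp

lemma riesz_lint {d : ℕ} (hd : 0 < d) (x : EuclideanSpace ℝ (Fin d)) (hx : x ≠ 0) {s u p q w : ℝ}
    (hs : 0 < s) (hu : 0 < u) (hp : 0 < p) (hq : 0 < q) (hw : 0 < w)
    (hps : p = (d : ℝ) / 2 - s) (hqu : q = (d : ℝ) / 2 - u) (hwd : w = s + u - (d : ℝ) / 2) :
    ENNReal.ofReal (Real.Gamma s * Real.Gamma u) *
      ∫⁻ y : EuclideanSpace ℝ (Fin d), ENNReal.ofReal (‖x - y‖ ^ (-(2 * s)) * ‖y‖ ^ (-(2 * u))) =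
    ENNReal.ofReal (Real.pi ^ ((d : ℝ) / 2) * Real.Gamma w * ‖x‖ ^ (-(2 * w)) *
      (Real.Gamma p * Real.Gamma q / Real.Gamma (p + q))) := by
  have hGs := Real.Gamma_pos_of_pos hs
  have hGu := Real.Gamma_pos_of_pos hu
  have hGw := Real.Gamma_pos_of_pos hw
  have hxn : 0 < ‖x‖ := norm_pos_iff.mpr hx
  have : NeZero d := ⟨hd.ne'⟩
  have : Nonempty (Fin d) := ⟨0⟩
  have : Nontrivial (EuclideanSpace ℝ (Fin d)) := ⟨x, 0, hx⟩
  let H : EuclideanSpace ℝ (Fin d) → ℝ → ℝ → ENNReal := fun y t v =>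
    ENNReal.ofReal t * (ENNReal.ofReal (t ^ (s - 1) * Real.exp (-(‖x - y‖ ^ 2 * t))) *
      ENNReal.ofReal ((t * v) ^ (u - 1) * Real.exp (-(‖y‖ ^ 2 * (t * v)))))
  have hH : Measurable fun z : (EuclideanSpace ℝ (Fin d) × ℝ) × ℝ => H z.1.1 z.1.2 z.2 := by
    simp only [H]
    fun_prop
  have hpow : ∀ (z : EuclideanSpace ℝ (Fin d)) (a : ℝ), z ≠ 0 →
      (1 / ‖z‖ ^ 2) ^ a = ‖z‖ ^ (-(2 * a)) := by
    intro z a hz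
    have : 0 < ‖z‖ := norm_pos_iff.mpr hz
    rw [one_div, Real.inv_rpow (by positivity), ← Real.rpow_natCast, ← Real.rpow_mul this.le,
      Real.rpow_neg this.le]
    norm_num
  have e1 : ∀ᵐ y : EuclideanSpace ℝ (Fin d), ENNReal.ofReal (Real.Gamma s * Real.Gamma u) *
      ENNReal.ofReal (‖x - y‖ ^ (-(2 * s)) * ‖y‖ ^ (-(2 * u))) =
      ∫⁻ t in Set.Ioi (0 : ℝ), ∫⁻ v in Set.Ioi (0 : ℝ), H y t v := by
    have h0 : ∀ᵐ y : EuclideanSpace ℝ (Fin d), y ≠ 0 := by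
      simp [ae_iff]
    have h1 : ∀ᵐ y : EuclideanSpace ℝ (Fin d), y ≠ x := by
      simp [ae_iff]
    filter_upwards [h0, h1] with y hy hyx
    have hyn : 0 < ‖y‖ := norm_pos_iff.mpr hy
    have hxy : x - y ≠ 0 := sub_ne_zero.mpr hyx.symm
    have hxyn : 0 < ‖x - y‖ := norm_pos_iff.mpr hxy
    have i1 : ∀ t ∈ Set.Ioi (0 : ℝ), (∫⁻ v in Set.Ioi (0 : ℝ), H y t v) =
        ENNReal.ofReal (t ^ (s - 1) * Real.exp (-(‖x - y‖ ^ 2 * t))) *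
          ENNReal.ofReal ((1 / ‖y‖ ^ 2) ^ u * Real.Gamma u) := by
      intro t ht
      rw [← lint_gamma hu (by positivity : 0 < ‖y‖ ^ 2),
        ← lintegral_const_mul' _ _ ENNReal.ofReal_ne_top]
      symm
      exact lint_scale ht fun a => ENNReal.ofReal (t ^ (s - 1) * Real.exp (-(‖x - y‖ ^ 2 * t))) *
        ENNReal.ofReal (a ^ (u - 1) * Real.exp (-(‖y‖ ^ 2 * a)))
    rw [setLIntegral_congr_fun measurableSet_Ioi i1, lintegral_mul_const' _ _ ENNReal.ofReal_ne_top,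
      lint_gamma hs (by positivity), hpow _ _ hy, hpow _ _ hxy,
      ← ENNReal.ofReal_mul (by positivity), ← ENNReal.ofReal_mul (by positivity)]
    congr 1
    ring
  have e2 : ∀ v ∈ Set.Ioi (0 : ℝ), ∀ t ∈ Set.Ioi (0 : ℝ),
      (∫⁻ y : EuclideanSpace ℝ (Fin d), H y t v) =
      ENNReal.ofReal (Real.pi ^ ((d : ℝ) / 2) * v ^ (u - 1) * (1 + v) ^ (-((d : ℝ) / 2))) *
        ENNReal.ofReal (t ^ (w - 1) * Real.exp (-(v / (1 + v) * ‖x‖ ^ 2 * t))) := by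
    intro v hv t ht
    have hv : 0 < v := hv
    have ht : 0 < t := ht
    have : ∀ y, H y t v = ENNReal.ofReal (t * t ^ (s - 1) * (t * v) ^ (u - 1)) *
        ENNReal.ofReal (Real.exp (-(‖x - y‖ ^ 2 * t) + -(‖y‖ ^ 2 * (t * v)))) := by
      intro y
      simp only [H]
      rw [← ENNReal.ofReal_mul (by positivity), ← ENNReal.ofReal_mul (by positivity),
        ← ENNReal.ofReal_mul (by positivity), Real.exp_add]
      congr 1
      ring
    simp_rw [this]
    rw [lintegral_const_mul' _ _ ENNReal.ofReal_ne_top, lint_gauss x ht (by positivity),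
      ← ENNReal.ofReal_mul (by positivity), ← ENNReal.ofReal_mul (by positivity)]
    congr 1
    have h1v : 0 < 1 + v := by positivity
    rw [show t * (t * v) / (t + t * v) * ‖x‖ ^ 2 = v / (1 + v) * ‖x‖ ^ 2 * t by field_simp,
      ← mul_assoc, ← mul_assoc]
    congr 1
    rw [show t + t * v = t * (1 + v) by ring]
    generalize 1 + v = z at h1v
    obtain ⟨a, rfl⟩ := exists_exp ht
    obtain ⟨b, rfl⟩ := exists_exp hv
    obtain ⟨c, rfl⟩ := exists_exp h1v
    obtain ⟨e, he⟩ := exists_exp Real.pi_pos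
    rw [he]
    simp only [← Real.exp_add, ← Real.exp_sub, ← Real.exp_mul]
    congr 1
    rw [hwd]
    ring
  have e3 : ∀ v ∈ Set.Ioi (0 : ℝ),
      (∫⁻ t in Set.Ioi (0 : ℝ), ∫⁻ y : EuclideanSpace ℝ (Fin d), H y t v) =
      ENNReal.ofReal (Real.pi ^ ((d : ℝ) / 2) * Real.Gamma w * ‖x‖ ^ (-(2 * w))) *
        ENNReal.ofReal (v ^ (p - 1) * (1 + v) ^ (-(p + q))) := by
    intro v hv
    have hv' : 0 < v := hv
    have h1v : 0 < 1 + v := by positivity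
    rw [setLIntegral_congr_fun measurableSet_Ioi (e2 v hv),
      lintegral_const_mul' _ _ ENNReal.ofReal_ne_top, lint_gamma hw (by positivity),
      ← ENNReal.ofReal_mul (by positivity), ← ENNReal.ofReal_mul (by positivity)]
    congr 1
    rw [show 1 / (v / (1 + v) * ‖x‖ ^ 2) = (1 + v) / v * (1 / ‖x‖ ^ 2) by field_simp,
      Real.mul_rpow (by positivity) (by positivity), hpow _ _ hx]
    have : v ^ (p - 1) * (1 + v) ^ (-(p + q)) =
        v ^ (u - 1) * (1 + v) ^ (-((d : ℝ) / 2)) * ((1 + v) / v) ^ w := by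
      generalize 1 + v = z at h1v
      obtain ⟨b, rfl⟩ := exists_exp hv'
      obtain ⟨c, rfl⟩ := exists_exp h1v
      simp only [← Real.exp_add, ← Real.exp_sub, ← Real.exp_mul]
      congr 1
      rw [hwd, hps, hqu]
      ring
    rw [this]
    ring
  have m1 : Measurable fun z : EuclideanSpace ℝ (Fin d) × ℝ =>
      ∫⁻ v in Set.Ioi (0 : ℝ), H z.1 z.2 v := hH.lintegral_prod_right'
  have m2 : Measurable fun z : ℝ × ℝ => ∫⁻ y : EuclideanSpace ℝ (Fin d), H y z.1 z.2 := by
    have : Measurable fun z : (ℝ × ℝ) × EuclideanSpace ℝ (Fin d) => H z.2 z.1.1 z.1.2 :=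
      hH.comp (f := fun z : (ℝ × ℝ) × EuclideanSpace ℝ (Fin d) => ((z.2, z.1.1), z.1.2))
        (by fun_prop)
    exact this.lintegral_prod_right'
  rw [← lintegral_const_mul' _ _ ENNReal.ofReal_ne_top, lintegral_congr_ae e1,
    lintegral_lintegral_swap m1.aemeasurable]
  have sw : ∀ t, (∫⁻ y : EuclideanSpace ℝ (Fin d), ∫⁻ v in Set.Ioi (0 : ℝ), H y t v) =
      ∫⁻ v in Set.Ioi (0 : ℝ), ∫⁻ y : EuclideanSpace ℝ (Fin d), H y t v := by
    intro t
    apply lintegral_lintegral_swap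
    exact (hH.comp (f := fun z : EuclideanSpace ℝ (Fin d) × ℝ => ((z.1, t), z.2))
      (by fun_prop)).aemeasurable
  simp_rw [sw]
  rw [lintegral_lintegral_swap m2.aemeasurable, setLIntegral_congr_fun measurableSet_Ioi e3,
    lintegral_const_mul' _ _ ENNReal.ofReal_ne_top, lint_beta hp hq,
    ← ENNReal.ofReal_mul (by positivity)]

lemma riesz_int {d : ℕ} (hd : 0 < d) (x : EuclideanSpace ℝ (Fin d)) (hx : x ≠ 0) {s u p q w : ℝ}
    (hs : 0 < s) (hu : 0 < u) (hp : 0 < p) (hq : 0 < q) (hw : 0 < w)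
    (hps : p = (d : ℝ) / 2 - s) (hqu : q = (d : ℝ) / 2 - u) (hwd : w = s + u - (d : ℝ) / 2) :
    Real.Gamma s * Real.Gamma u *
      ∫ y : EuclideanSpace ℝ (Fin d), ‖x - y‖ ^ (-(2 * s)) * ‖y‖ ^ (-(2 * u)) =
    Real.pi ^ ((d : ℝ) / 2) * Real.Gamma w * ‖x‖ ^ (-(2 * w)) *
      (Real.Gamma p * Real.Gamma q / Real.Gamma (p + q)) := by
  have hGs := Real.Gamma_pos_of_pos hs
  have hGu := Real.Gamma_pos_of_pos hu
  have hGw := Real.Gamma_pos_of_pos hw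
  have hGp := Real.Gamma_pos_of_pos hp
  have hGq := Real.Gamma_pos_of_pos hq
  have hGpq := Real.Gamma_pos_of_pos (add_pos hp hq)
  have h := congrArg ENNReal.toReal (riesz_lint hd x hx hs hu hp hq hw hps hqu hwd)
  rw [ENNReal.toReal_mul, ENNReal.toReal_ofReal (by positivity),
    ENNReal.toReal_ofReal (by positivity)] at h
  rw [← h, integral_eq_lintegral_of_nonneg_ae]
  · exact Filter.Eventually.of_forall fun y => by
      simp only [Pi.zero_apply]
      positivity
  · apply Measurable.aestronglyMeasurable
    fun_prop

lemma div_part (d : ℕ) (κ α β : ℝ) (x : EuclideanSpace ℝ (Fin d)) (hx : x ≠ 0) :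
    pdiv (fun y : EuclideanSpace ℝ (Fin d) => (κ * ‖y‖ ^ (-α) * ‖y‖ ^ β) • y) x =
        κ * ((d : ℝ) + β - α) * ‖x‖ ^ (β - α) := by
  have hxn : 0 < ‖x‖ := norm_pos_iff.mpr hx
  have hev : (fun y : EuclideanSpace ℝ (Fin d) => (κ * ‖y‖ ^ (-α) * ‖y‖ ^ β) • y) =ᶠ[nhds x]
      fun y => (κ * (‖y‖ ^ 2) ^ ((β - α) / 2)) • y := by
    filter_upwards [isOpen_ne.mem_nhds hx] with y hy
    have hyn : 0 < ‖y‖ := norm_pos_iff.mpr hy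
    congr 1
    rw [mul_assoc, ← Real.rpow_add hyn, ← Real.rpow_natCast, ← Real.rpow_mul hyn.le]
    congr 2
    push_cast
    ring
  have h1 := (hasStrictFDerivAt_norm_sq x).hasFDerivAt.rpow_const (p := (β - α) / 2)
    (Or.inl (by positivity))
  have h2 := (h1.const_mul κ).smul (hasFDerivAt_id x)
  have h3 : fderiv ℝ (fun y : EuclideanSpace ℝ (Fin d) => (κ * ‖y‖ ^ (-α) * ‖y‖ ^ β) • y) x = _ :=
    hev.fderiv_eq.trans h2.fderiv
  unfold pdiv
  rw [h3]
  have hsum : ∑ i, x i ^ 2 = ‖x‖ ^ 2 := by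
    rw [EuclideanSpace.norm_sq_eq]; simp
  have hp1 : (‖x‖ ^ 2) ^ ((β - α) / 2) = ‖x‖ ^ (β - α) := by
    rw [← Real.rpow_natCast, ← Real.rpow_mul hxn.le]
    congr 1; push_cast; ring
  have hp2 : (‖x‖ ^ 2) ^ ((β - α) / 2 - 1) * ‖x‖ ^ 2 = ‖x‖ ^ (β - α) := by
    rw [← hp1, Real.rpow_sub_one (by positivity)]
    field_simp
  have : ∀ i : Fin d, ((κ * (‖x‖ ^ 2) ^ ((β - α) / 2)) • ContinuousLinearMap.id ℝ (EuclideanSpace ℝ (Fin d)) +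
     (κ • (((β - α) / 2 * (‖x‖ ^ 2) ^ ((β - α) / 2 - 1)) • (2 • innerSL ℝ x))).smulRight x) (EuclideanSpace.single i 1) i
     = κ * ‖x‖ ^ (β - α) + κ * (β - α) * (‖x‖ ^ 2) ^ ((β - α) / 2 - 1) * x i ^ 2 := by
    intro i
    rw [← hp1]
    have hin : inner ℝ x (EuclideanSpace.single i (1 : ℝ)) = x i := by
      rw [EuclideanSpace.inner_single_right]; simp
    simp [hin]
    ring
  trans ∑ i : Fin d, (κ * ‖x‖ ^ (β - α) + κ * (β - α) * (‖x‖ ^ 2) ^ ((β - α) / 2 - 1) * x i ^ 2)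
  · exact Finset.sum_congr rfl fun i _ => this i
  rw [Finset.sum_add_distrib, ← Finset.mul_sum _ _ (κ * (β - α) * (‖x‖ ^ 2) ^ ((β - α) / 2 - 1)), hsum,
    mul_assoc _ _ (‖x‖ ^ 2), hp2]
  simp
  ring

/-- `|x|^β` is a Lyapunov function of `(−Δ)^{α/2} + ∇·(κ|x|^{−α}x)`:
the divergence of `y ↦ κ|y|^{−α}|y|^{β} y` equals `κ(d+β−α)|x|^{β−α}`, and the Riesz-potential
representation of `(−Δ)^{α/2}|x|^β` has the same value. -/
theorem lyapunov_identity (d : ℕ) (hd : 3 ≤ d) (α β κ : ℝ) (hα0 : 0 < α) (hα1 : α ≤ 1)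
    (hκ : 0 < κ) (hβ : β ∈ Set.Ioo (0 : ℝ) α)
    (hbeta : β * (((d : ℝ) + β - 2) / ((d : ℝ) + β - α)) *
      (gam d ((d : ℝ) + β - 2) / gam d ((d : ℝ) + β - α)) = κ)
    (x : EuclideanSpace ℝ (Fin d)) (hx : x ≠ 0) :
    pdiv (fun y : EuclideanSpace ℝ (Fin d) => (κ * ‖y‖ ^ (-α) * ‖y‖ ^ β) • y) x =
        κ * ((d : ℝ) + β - α) * ‖x‖ ^ (β - α) ∧
      β * ((d : ℝ) + β - 2) / gam d (2 - α) *
          ∫ y : EuclideanSpace ℝ (Fin d), ‖x - y‖ ^ (2 - α - (d : ℝ)) * ‖y‖ ^ (β - 2) =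
        κ * ((d : ℝ) + β - α) * ‖x‖ ^ (β - α) := by
  refine ⟨div_part d κ α β x hx, ?_⟩
  obtain ⟨hβ0, hβα⟩ := hβ
  have hd3 : (3 : ℝ) ≤ d := by exact_mod_cast hd
  have key := riesz_int (d := d) (by omega) x hx (s := ((d : ℝ) - (2 - α)) / 2) (u := (2 - β) / 2)
    (p := (2 - α) / 2) (q := ((d : ℝ) + β - 2) / 2) (w := (α - β) / 2)
    (by linarith) (by linarith) (by linarith) (by linarith) (by linarith) (by ring) (by ring)
    (by ring)
  rw [show -(2 * (((d : ℝ) - (2 - α)) / 2)) = 2 - α - d by ring,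
    show -(2 * ((2 - β) / 2)) = β - 2 by ring, show -(2 * ((α - β) / 2)) = β - α by ring,
    show (2 - α) / 2 + ((d : ℝ) + β - 2) / 2 = ((d : ℝ) + β - α) / 2 by ring] at key
  have g1 : 0 < Real.Gamma (((d : ℝ) - (2 - α)) / 2) := Real.Gamma_pos_of_pos (by linarith)
  have g2 : 0 < Real.Gamma ((2 - β) / 2) := Real.Gamma_pos_of_pos (by linarith)
  have g3 : 0 < Real.Gamma ((2 - α) / 2) := Real.Gamma_pos_of_pos (by linarith)
  have g4 : 0 < Real.Gamma (((d : ℝ) + β - 2) / 2) := Real.Gamma_pos_of_pos (by linarith)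
  have g5 : 0 < Real.Gamma ((α - β) / 2) := Real.Gamma_pos_of_pos (by linarith)
  have g6 : 0 < Real.Gamma (((d : ℝ) + β - α) / 2) := Real.Gamma_pos_of_pos (by linarith)
  have hI : ∫ y : EuclideanSpace ℝ (Fin d), ‖x - y‖ ^ (2 - α - (d : ℝ)) * ‖y‖ ^ (β - 2) =
      gam d (2 - α) * (gam d ((d : ℝ) + β - 2) / gam d ((d : ℝ) + β - α)) * ‖x‖ ^ (β - α) := by
    have h2 : (2 : ℝ) ^ ((d : ℝ) + β - α) = 2 ^ (2 - α) * 2 ^ ((d : ℝ) + β - 2) := by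
      rw [← Real.rpow_add two_pos]; congr 1; ring
    have hA : (0 : ℝ) < 2 ^ (2 - α) := by positivity
    have hB : (0 : ℝ) < 2 ^ ((d : ℝ) + β - 2) := by positivity
    have hP : (0 : ℝ) < Real.pi ^ ((d : ℝ) / 2) := by positivity
    unfold gam
    rw [show ((d : ℝ) - (d + β - 2)) / 2 = (2 - β) / 2 by ring,
      show ((d : ℝ) - (d + β - α)) / 2 = (α - β) / 2 by ring, h2]
    apply mul_left_cancel₀ (mul_pos g1 g2).ne'
    rw [key]
    field_simp
  have hg : gam d (2 - α) ≠ 0 := by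
    unfold gam
    positivity
  have hne : (d : ℝ) + β - α ≠ 0 := by
    have : 0 < (d : ℝ) + β - α := by linarith
    exact this.ne'
  rw [hI, ← hbeta]
  generalize gam d ((d : ℝ) + β - 2) / gam d ((d : ℝ) + β - α) = R
  field_simp
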